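/- arXiv:2501.10616 — 7 statements merged into one kernel-verified Lean document; each statement's English description precedes it below -/
import Mathlib

section
/- For all integers n ≥ 1 and all odd integers k with 1 ≤ k ≤ n, the partial evaluation for the sequence of positive integers satisfies ℕ^φ(n,k) ≤ 2k + 4. -/
/-- `scorePartial a n j` is the partial evaluation `A^φ(n, n - j)` of the
adversarial totient iteration for the sequence `a` (indexed from 1):
`scorePartial a n 0 = 0` corresponds to `A^φ(n,n) = 0`, and
`scorePartial a n (j+1) = φ(a (n-j) + scorePartial a n j)` corresponds to the
recurrence `A^φ(n,k-1) = φ(a_k + A^φ(n,k))` with `k = n - j`.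
Hence `A^φ(n,k) = scorePartial a n (n - k)`, and the scoreboard function is
`A^φ(n) = A^φ(n,0) = scorePartial a n n`. -/
def scorePartial (a : ℕ → ℕ) (n : ℕ) : ℕ → ℕ
  | 0 => 0
  | j + 1 => Nat.totient (a (n - j) + scorePartial a n j)

theorem totient_two_mul_le (m : ℕ) : Nat.totient (2 * m) ≤ m := by
  induction m using Nat.strong_induction_on with
  | _ m ih =>
    rcases Nat.even_or_odd m with h | h
    · rcases Nat.eq_zero_or_pos m with rfl | hpos
      · simp
      · rw [Nat.totient_two_mul_of_even h]
        obtain ⟨r, hr⟩ := h.two_dvd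
        have := ih r (by omega)
        rw [← hr] at this
        omega
    · rw [Nat.totient_two_mul_of_odd h]
      exact Nat.totient_le m

theorem totient_le_half_of_even {m : ℕ} (hm : Even m) : 2 * Nat.totient m ≤ m := by
  obtain ⟨r, rfl⟩ := hm.two_dvd
  have := totient_two_mul_le r
  omega

theorem scorePartial_id_add_le (k : ℕ) (hk : Odd k) (j : ℕ) :
    scorePartial (fun i => i) (k + j) j ≤ 2 * k + 4 := by
  induction j using Nat.strong_induction_on generalizing k with
  | _ j ih =>
    match j, ih with
    | 0, _ => simp [scorePartial]
    | 1, _ =>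
      have := Nat.totient_le (k + 1)
      simp only [scorePartial, Nat.sub_zero, Nat.add_zero]
      omega
    | j + 2, ih =>
      have hx := ih j (by omega) (k + 2) (by simpa [Nat.odd_add, parity_simps] using hk)
      have h₁ : k + (j + 2) - j = k + 2 := by omega
      have h₂ : k + (j + 2) - (j + 1) = k + 1 := by omega
      rw [show k + 2 + j = k + (j + 2) by omega] at hx
      simp only [scorePartial, h₁, h₂]
      generalize scorePartial (fun i => i) (k + (j + 2)) j = x at hx ⊢
      have hk0 := hk.pos
      have hy := Nat.totient_lt (k + 2 + x) (by omega)
      have hyeven : Even (Nat.totient (k + 2 + x)) := Nat.totient_even (by omega)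
      have hypos : 0 < Nat.totient (k + 2 + x) := Nat.totient_pos.mpr (by omega)
      generalize Nat.totient (k + 2 + x) = y at hy hyeven hypos ⊢
      have hz := totient_le_half_of_even (hk.add_one.add hyeven)
      have hzeven : Even (Nat.totient (k + 1 + y)) := Nat.totient_even (by omega)
      obtain ⟨r, hr⟩ := hzeven
      omega

theorem stmt_0 (n k : ℕ) (hn : 1 ≤ n) (hk : Odd k) (hk1 : 1 ≤ k) (hkn : k ≤ n) :
    scorePartial (fun j => j) n (n - k) ≤ 2 * k + 4 := by
  have h := scorePartial_id_add_le k hk (n - k)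
  rwa [Nat.add_sub_cancel' hkn] at h
end

section
/- For all integers n ≥ 1, ℕ^φ(n) = 2 if and only if n = 3 or n = 4. -/
theorem Odd.le_totient_sq {m : ℕ} (hm : Odd m) : m ≤ m.totient ^ 2 := by
  induction m using Nat.strong_induction_on with
  | _ m ih =>
    rcases eq_or_ne m 1 with rfl | h1
    · simp
    obtain ⟨p, hp, l, rfl⟩ := Nat.exists_prime_and_dvd h1
    obtain ⟨hpo, hlo⟩ := Nat.odd_mul.mp hm
    have hlt : l < p * l := by nlinarith [hp.two_le, hlo.pos]
    have hp3 : 3 ≤ p := by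
      have := hp.two_le
      obtain ⟨t, rfl⟩ := hpo
      omega
    have hsq : p ≤ p.totient ^ 2 := by
      rw [Nat.totient_prime hp]
      obtain ⟨t, rfl⟩ := Nat.exists_eq_add_of_le hp3
      rw [show 3 + t - 1 = t + 2 by omega]
      nlinarith
    calc p * l ≤ p.totient ^ 2 * l.totient ^ 2 := Nat.mul_le_mul hsq (ih l hlt hlo)
      _ = (p.totient * l.totient) ^ 2 := by ring
      _ ≤ (p * l).totient ^ 2 := Nat.pow_le_pow_left (Nat.totient_super_multiplicative p l) 2

theorem Nat.le_two_mul_totient_sq (m : ℕ) : m ≤ 2 * m.totient ^ 2 := by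
  induction m using Nat.strong_induction_on with
  | _ m ih =>
    rcases Nat.even_or_odd m with hm | hm
    · obtain ⟨l, rfl⟩ := even_iff_two_dvd.mp hm
      rcases Nat.even_or_odd l with hl | hl
      · rcases Nat.eq_zero_or_pos l with rfl | hpos
        · simp
        rw [Nat.totient_two_mul_of_even hl]
        nlinarith [ih l (by omega)]
      · rw [Nat.totient_two_mul_of_odd hl]
        nlinarith [hl.le_totient_sq]
    · nlinarith [hm.le_totient_sq]

theorem Nat.totient_eq_two {m : ℕ} (h : m.totient = 2) : m = 3 ∨ m = 4 ∨ m = 6 := by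
  have hle : m ≤ 8 := by simpa [h] using m.le_two_mul_totient_sq
  interval_cases m <;> revert h <;> decide

theorem Nat.totient_eq_four {m : ℕ} (h : m.totient = 4) :
    m = 5 ∨ m = 8 ∨ m = 10 ∨ m = 12 := by
  have hle : m ≤ 32 := by simpa [h] using m.le_two_mul_totient_sq
  interval_cases m <;> revert h <;> decide

theorem scorePartial_id_add_ne_two (m : ℕ) :
    scorePartial (fun j => j) (m + 6) (m + 6) ≠ 2 := by
  have step (i k : ℕ) (h : i + k = m + 6) :
      scorePartial (fun j => j) (m + 6) (i + 1) =
        Nat.totient (k + scorePartial (fun j => j) (m + 6) i) := by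
    rw [scorePartial, show m + 6 - i = k by omega]
  have even_step (i k : ℕ) (h : i + k = m + 6) (hk : 3 ≤ k) :
      Even (scorePartial (fun j => j) (m + 6) (i + 1)) := by
    rw [step i k h]
    exact Nat.totient_even (by omega)
  have h1 := step (m + 5) 1 (by omega)
  have h2 := step (m + 4) 2 (by omega)
  have h3 := step (m + 3) 3 (by omega)
  have h4 := step (m + 2) 4 (by omega)
  have h5 := step (m + 1) 5 (by omega)
  have e2 : Even (scorePartial (fun j => j) (m + 6) (m + 4)) :=
    even_step (m + 3) 3 (by omega) le_rfl
  have e3 : Even (scorePartial (fun j => j) (m + 6) (m + 3)) :=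
    even_step (m + 2) 4 (by omega) (by omega)
  have e4 : Even (scorePartial (fun j => j) (m + 6) (m + 2)) :=
    even_step (m + 1) 5 (by omega) (by omega)
  have e5 := even_step m 6 (by omega) (by omega)
  have p2 : 0 < scorePartial (fun j => j) (m + 6) (m + 4) := by
    rw [h3]; exact Nat.totient_pos.mpr (by omega)
  have e1 : Even (scorePartial (fun j => j) (m + 6) (m + 5)) := by
    rw [h2]; exact Nat.totient_even (by omega)
  have p3 : 0 < scorePartial (fun j => j) (m + 6) (m + 3) := by
    rw [h4]; exact Nat.totient_pos.mpr (by omega)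
  have p4 : 0 < scorePartial (fun j => j) (m + 6) (m + 2) := by
    rw [h5]; exact Nat.totient_pos.mpr (by omega)
  rw [Nat.even_iff] at e1 e2 e3 e4 e5
  intro h
  have v1 : scorePartial (fun j => j) (m + 6) (m + 5) = 2 := by
    have := Nat.totient_eq_two (h1.symm.trans h)
    omega
  have v2 : scorePartial (fun j => j) (m + 6) (m + 4) = 2 ∨
      scorePartial (fun j => j) (m + 6) (m + 4) = 4 := by
    have := Nat.totient_eq_two (h2.symm.trans v1)
    omega
  have v3 : scorePartial (fun j => j) (m + 6) (m + 3) = 2 := by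
    rcases v2 with v2 | v2
    · have := Nat.totient_eq_two (h3.symm.trans v2)
      omega
    · have := Nat.totient_eq_four (h3.symm.trans v2)
      omega
  have v4 : scorePartial (fun j => j) (m + 6) (m + 2) = 2 := by
    have := Nat.totient_eq_two (h4.symm.trans v3)
    omega
  have := Nat.totient_eq_two (h5.symm.trans v4)
  omega

theorem stmt_5 (n : ℕ) (hn : 1 ≤ n) :
    scorePartial (fun j => j) n n = 2 ↔ n = 3 ∨ n = 4 := by
  rcases lt_or_ge n 6 with h | h
  · interval_cases n <;> decide
  · obtain ⟨m, rfl⟩ := Nat.exists_eq_add_of_le' h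
    exact iff_of_false (scorePartial_id_add_ne_two m) (by omega)
end

section
/- For all integers n ≥ 1, ℕ^φ(n) ≠ 6; that is, the nested expression φ(1+φ(2+φ(3+...+φ(n)...))) never takes the value 6. -/
/-- The partial evaluations for `a_k = k` at index `k = n - j ≥ 2` are even and grow at most
linearly in `k`. -/
theorem scorePartial_id_even_and_le (n j : ℕ) (hj : j + 2 ≤ n) :
    Even (scorePartial (fun i => i) n j) ∧
      (Even (n - j) → scorePartial (fun i => i) n j ≤ 3 * (n - j) + 8) ∧
      (Odd (n - j) → scorePartial (fun i => i) n j ≤ 2 * (n - j) + 6) := by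
  induction j with
  | zero => simp [scorePartial]
  | succ j ih =>
    obtain ⟨he, h_even, h_odd⟩ := ih (by omega)
    obtain ⟨k, hk⟩ : ∃ k, n - j = k + 1 := ⟨n - j - 1, by omega⟩
    have hk' : n - (j + 1) = k := by omega
    rw [hk] at h_even h_odd
    rw [hk']
    simp only [scorePartial, hk]
    generalize scorePartial (fun i => i) n j = s at *
    refine ⟨Nat.totient_even (by omega), fun hp => ?_, fun hp => ?_⟩
    · have h1 := h_odd hp.add_one
      have h2 := Nat.totient_lt (k + 1 + s) (by omega)
      omega
    · have h1 := h_even hp.add_one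
      obtain ⟨m, hm⟩ := hp.add_one.add he
      have h2 := totient_two_mul_le m
      rw [hm, ← two_mul]
      omega

theorem stmt_6 (n : ℕ) (hn : 1 ≤ n) :
    scorePartial (fun j => j) n n ≠ 6 := by
  rcases Nat.lt_or_ge n 6 with h | h
  · interval_cases n <;> decide
  · obtain ⟨j, rfl⟩ : ∃ j, n = j + 6 := ⟨n - 6, by omega⟩
    obtain ⟨he, h_le, -⟩ := scorePartial_id_even_and_le (j + 6) j (by omega)
    have h0 : j + 6 - j = 6 := by omega
    have h1 : j + 6 - (j + 1) = 5 := by omega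
    have h2 : j + 6 - (j + 2) = 4 := by omega
    have h3 : j + 6 - (j + 3) = 3 := by omega
    have h4 : j + 6 - (j + 4) = 2 := by omega
    have h5 : j + 6 - (j + 5) = 1 := by omega
    rw [h0] at h_le
    have hs := h_le (by decide)
    simp only [scorePartial, h0, h1, h2, h3, h4, h5]
    generalize scorePartial (fun i => i) (j + 6) j = s at *
    have key : ∀ s < 27, Even s → Nat.totient (1 + Nat.totient (2 + Nat.totient (3 +
        Nat.totient (4 + Nat.totient (5 + Nat.totient (6 + s)))))) ≠ 6 := by
      decide
    exact key s (by omega) he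
end

section
/- For all integers n ≥ 5, ℕ^φ(n) = φ(1+φ(2+φ(3+...+φ(n)...))) = 4. -/
theorem Nat.totient_two_mul_le (r : ℕ) : (2 * r).totient ≤ r := by
  induction r using Nat.strong_induction_on with
  | h r ih =>
    by_cases h : 2 ∣ r
    · obtain ⟨s, rfl⟩ := h
      rcases s.eq_zero_or_pos with rfl | hs
      · simp
      · rw [Nat.totient_mul_of_prime_of_dvd Nat.prime_two (dvd_mul_right 2 s)]
        have := ih s (by lia)
        lia
    · rw [Nat.totient_mul_of_prime_of_not_dvd Nat.prime_two h]
      have := r.totient_le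
      lia

theorem Nat.two_mul_totient_le_of_even {m : ℕ} (hm : Even m) : 2 * m.totient ≤ m := by
  obtain ⟨r, rfl⟩ := hm.two_dvd
  exact Nat.mul_le_mul_left 2 r.totient_two_mul_le

/-- The partial evaluations `ℕ^φ(n, k)` with `k ≥ 2` are even, and they are bounded linearly in
`k` independently of `n`. -/
theorem even_scorePartial_and_le (n j : ℕ) (hj : j + 2 ≤ n) :
    Even (scorePartial (fun i => i) n j) ∧
      (Odd (n - j) → scorePartial (fun i => i) n j ≤ 2 * (n - j) + 6) ∧
      (Even (n - j) → scorePartial (fun i => i) n j ≤ 3 * (n - j) + 8) := by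
  induction j with
  | zero => simp [scorePartial]
  | succ j ih =>
    obtain ⟨hx, hodd, heven⟩ := ih (by lia)
    simp only [scorePartial]
    generalize scorePartial (fun i => i) n j = x at *
    obtain ⟨k, hk⟩ : ∃ k, n - j = k + 1 := ⟨n - j - 1, by lia⟩
    have hk' : n - (j + 1) = k := by lia
    rw [hk] at hodd heven ⊢
    rw [hk']
    refine ⟨Nat.totient_even (by lia), fun hko => ?_, fun hke => ?_⟩
    · have h := heven hko.add_one
      have := Nat.two_mul_totient_le_of_even (hko.add_one.add hx)
      lia
    · have h := hodd hke.add_one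
      have := Nat.totient_lt (k + 1 + x) (by lia)
      lia

theorem stmt_7 (n : ℕ) (hn : 5 ≤ n) :
    scorePartial (fun j => j) n n = 4 := by
  obtain rfl | hn := hn.eq_or_lt
  · decide
  obtain ⟨m, rfl⟩ := Nat.exists_eq_add_of_le' (Nat.succ_le_of_lt hn)
  obtain ⟨hx, -, hle⟩ := even_scorePartial_and_le (m + 6) m (by lia)
  rw [Nat.add_sub_cancel_left] at hle
  have hle := hle (by decide)
  simp only [scorePartial, Nat.add_sub_cancel_left, Nat.add_sub_add_left]
  generalize scorePartial (fun j => j) (m + 6) m = x at *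
  have key : ∀ x ≤ 26, Even x → Nat.totient (1 + Nat.totient (2 + Nat.totient (3 +
      Nat.totient (4 + Nat.totient (5 + Nat.totient (6 + x)))))) = 4 := by decide
  exact key x hle hx
end

section
/- Let A = (1, 4, 9, ...) be the sequence of perfect squares, a_k = k². For all integers n ≥ 1 and all even integers ℓ with 0 ≤ ℓ ≤ n, the partial evaluation satisfies A^φ(n,ℓ) ≤ 3ℓ² + 20ℓ + 57. -/
theorem even_scorePartial_sq (n j : ℕ) (h : j + 2 ≤ n) :
    Even (scorePartial (fun j => j ^ 2) n j) := by
  cases j with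
  | zero => simp [scorePartial]
  | succ j =>
    apply Nat.totient_even
    have : 2 ≤ n - j := by omega
    change 2 < (n - j) ^ 2 + _
    nlinarith

theorem scorePartial_sq_le (n : ℕ) : ∀ j l : ℕ, Even l → l + j = n →
    scorePartial (fun j => j ^ 2) n j ≤ 3 * l ^ 2 + 20 * l + 57
  | 0, l, _, _ => by simp [scorePartial]
  | 1, l, _, h => by
    have := Nat.totient_le (n ^ 2)
    simp only [scorePartial, Nat.sub_zero, Nat.add_zero]
    subst h
    nlinarith
  | j + 2, l, hl, h => by
    have ih := scorePartial_sq_le n j (l + 2) (hl.add even_two) (by omega)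
    have he := even_scorePartial_sq n j (by omega)
    have h1 : n - j = l + 2 := by omega
    have h2 : n - (j + 1) = l + 1 := by omega
    simp only [scorePartial, h1, h2]
    generalize scorePartial (fun j => j ^ 2) n j = s at ih he ⊢
    obtain ⟨m, hm⟩ : Even ((l + 2) ^ 2 + s) :=
      ((hl.add even_two).pow_of_ne_zero two_ne_zero).add he
    have hle : Nat.totient ((l + 2) ^ 2 + s) ≤ m := by
      rw [hm, ← two_mul]
      exact totient_two_mul_le m
    have hpos : 0 < Nat.totient ((l + 2) ^ 2 + s) := Nat.totient_pos.2 (by positivity)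
    have hlt := Nat.totient_lt ((l + 1) ^ 2 + Nat.totient ((l + 2) ^ 2 + s)) (by nlinarith)
    nlinarith

theorem stmt_9 (n l : ℕ) (hn : 1 ≤ n) (hl : Even l) (hln : l ≤ n) :
    scorePartial (fun j => j ^ 2) n (n - l) ≤ 3 * l ^ 2 + 20 * l + 57 :=
  scorePartial_sq_le n (n - l) l hl (by omega)
end

section
/- Let A = (1, 4, 9, ...) be the sequence of perfect squares, a_k = k². For all integers n ≥ 1, A^φ(n) = 22 if and only if n belongs to the set {9,14,15,17,24,26,30,31,32,33,34,35,38,40,47,53,59,69}. -/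
namespace SquareScore

/-- Application of `f` to `x`, by cases on `x`: the kernel normalizes `x` before it substitutes. -/
noncomputable def force {α : Type} (x : ℕ) (f : ℕ → α) : α :=
  Nat.rec (f 0) (fun m _ => f m.succ) x

theorem force_eq {α : Type} (x : ℕ) (f : ℕ → α) : force x f = f x := by
  cases x <;> rfl

/-- Totient by trial division with `d`, `d + 2`, ..., at most `fuel` steps, for an odd number
without prime factors below the odd number `d`. -/
noncomputable def totientOdd (fuel : ℕ) : ℕ → ℕ → ℕ :=
  Nat.rec (fun _ n => Nat.totient n)
    (fun _ ih d n =>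
      bif Nat.ble (d * d) n then
        bif Nat.beq (n % d) 0 then
          force (n / d) fun q =>
            bif Nat.beq (q % d) 0 then d * ih d q else (d - 1) * force (d + 2) fun e => ih e q
        else force (d + 2) fun e => ih e n
      else bif Nat.beq n 1 then 1 else n - 1)
    fuel

/-- Totient by trial division, splitting off the powers of two first. -/
noncomputable def totientFast (fuel : ℕ) : ℕ → ℕ :=
  Nat.rec (fun n => Nat.totient n)
    (fun _ ih n =>
      bif Nat.beq (n % 2) 0 then
        force (n / 2) fun q =>
          bif Nat.beq (q % 2) 0 then 2 * ih q else totientOdd 200 3 q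
      else totientOdd 200 3 n)
    fuel

theorem totientOdd_succ (f d n : ℕ) : totientOdd (f + 1) d n =
    if d * d ≤ n then
      if n % d = 0 then
        if n / d % d = 0 then d * totientOdd f d (n / d)
        else (d - 1) * totientOdd f (d + 2) (n / d)
      else totientOdd f (d + 2) n
    else if n = 1 then 1 else n - 1 := by
  have h : totientOdd (f + 1) d n =
      bif Nat.ble (d * d) n then
        bif Nat.beq (n % d) 0 then
          force (n / d) fun q =>
            bif Nat.beq (q % d) 0 then d * totientOdd f d q
            else (d - 1) * force (d + 2) fun e => totientOdd f e q
        else force (d + 2) fun e => totientOdd f e n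
      else bif Nat.beq n 1 then 1 else n - 1 := rfl
  rw [h]
  simp only [force_eq, Bool.cond_eq_ite, Nat.ble_eq, Nat.beq_eq]

theorem totientFast_succ (f n : ℕ) : totientFast (f + 1) n =
    if n % 2 = 0 then
      if n / 2 % 2 = 0 then 2 * totientFast f (n / 2) else totientOdd 200 3 (n / 2)
    else totientOdd 200 3 n := by
  have h : totientFast (f + 1) n =
      bif Nat.beq (n % 2) 0 then
        force (n / 2) fun q =>
          bif Nat.beq (q % 2) 0 then 2 * totientFast f q else totientOdd 200 3 q
      else totientOdd 200 3 n := rfl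
  rw [h]
  simp only [force_eq, Bool.cond_eq_ite, Nat.beq_eq]

theorem totientOdd_eq (f : ℕ) : ∀ d n : ℕ, 0 < n → Odd n → Odd d → 3 ≤ d →
    (∀ p, p.Prime → p ∣ n → d ≤ p) → totientOdd f d n = Nat.totient n := by
  induction f with
  | zero => intros; rfl
  | succ f ih =>
    intro d n hn hno hdo hd hp
    have step : ∀ q, q ∣ n → ¬ d ∣ q → ∀ p, p.Prime → p ∣ q → d + 2 ≤ p := by
      intro q hqn hdq p hpp hpq
      have h1 := hp p hpp (hpq.trans hqn)
      have h2 : p ≠ d := fun h => hdq (h ▸ hpq)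
      have h3 : Odd p := hno.of_dvd_nat (hpq.trans hqn)
      obtain ⟨a, rfl⟩ := h3
      obtain ⟨b, rfl⟩ := hdo
      omega
    have hdo2 : Odd (d + 2) := hdo.add_even even_two
    rw [totientOdd_succ]
    split_ifs with h1 h2 h3 h3
    · have hdn : d ∣ n := Nat.dvd_of_mod_eq_zero h2
      have hdp : d.Prime := by
        have h4 := hp _ (Nat.minFac_prime (by omega : d ≠ 1)) ((Nat.minFac_dvd d).trans hdn)
        have h5 := Nat.minFac_le (by omega : 0 < d)
        exact (le_antisymm h5 h4) ▸ Nat.minFac_prime (by omega : d ≠ 1)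
      obtain ⟨q, rfl⟩ := hdn
      rw [Nat.mul_div_cancel_left _ (by omega)] at h3 ⊢
      rw [Nat.totient_mul_of_prime_of_dvd hdp (Nat.dvd_of_mod_eq_zero h3),
        ih d q (Nat.pos_of_mul_pos_left hn) (hno.of_dvd_nat (Dvd.intro_left _ rfl)) hdo hd
          fun p hpp hpq => hp p hpp (hpq.trans (Dvd.intro_left _ rfl))]
    · have hdn : d ∣ n := Nat.dvd_of_mod_eq_zero h2
      have hdp : d.Prime := by
        have h4 := hp _ (Nat.minFac_prime (by omega : d ≠ 1)) ((Nat.minFac_dvd d).trans hdn)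
        have h5 := Nat.minFac_le (by omega : 0 < d)
        exact (le_antisymm h5 h4) ▸ Nat.minFac_prime (by omega : d ≠ 1)
      obtain ⟨q, rfl⟩ := hdn
      rw [Nat.mul_div_cancel_left _ (by omega)] at h3 ⊢
      have hdq : ¬ d ∣ q := fun h => h3 (Nat.mod_eq_zero_of_dvd h)
      rw [Nat.totient_mul_of_prime_of_not_dvd hdp hdq,
        ih (d + 2) q (Nat.pos_of_mul_pos_left hn) (hno.of_dvd_nat (Dvd.intro_left _ rfl)) hdo2
          (by omega) (step q (Dvd.intro_left _ rfl) hdq)]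
    · exact ih (d + 2) n hn hno hdo2 (by omega)
        (step n dvd_rfl fun h => h2 (Nat.mod_eq_zero_of_dvd h))
    · rw [h3, Nat.totient_one]
    · have hpr : n.Prime := by
        by_contra hnp
        have h4 := Nat.minFac_sq_le_self hn hnp
        have h5 := hp _ (Nat.minFac_prime h3) (Nat.minFac_dvd n)
        nlinarith
      rw [Nat.totient_prime hpr]

theorem totientOdd_three (f n : ℕ) (hno : Odd n) : totientOdd f 3 n = Nat.totient n := by
  refine totientOdd_eq f 3 n hno.pos hno (by decide) le_rfl fun p hpp hpn => ?_
  obtain ⟨a, rfl⟩ := hno.of_dvd_nat hpn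
  have := hpp.two_le
  omega

theorem totientFast_eq (f : ℕ) : ∀ n, totientFast f n = Nat.totient n := by
  induction f with
  | zero => intro n; rfl
  | succ f ih =>
    intro n
    rw [totientFast_succ]
    split_ifs with h1 h2
    · obtain ⟨q, rfl⟩ := Nat.dvd_of_mod_eq_zero h1
      rw [Nat.mul_div_cancel_left _ (by omega)] at h2 ⊢
      rw [Nat.totient_mul_of_prime_of_dvd Nat.prime_two (Nat.dvd_of_mod_eq_zero h2), ih]
    · obtain ⟨q, rfl⟩ := Nat.dvd_of_mod_eq_zero h1
      rw [Nat.mul_div_cancel_left _ (by omega)] at h2 ⊢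
      rw [Nat.totient_mul_of_prime_of_not_dvd Nat.prime_two
        fun h => h2 (Nat.mod_eq_zero_of_dvd h), totientOdd_three _ _ (Nat.odd_iff.2 (by omega))]
      omega
    · exact totientOdd_three _ _ (Nat.odd_iff.2 (by omega))

/-- If `mask` is the bit mask of a set `s` of numbers below `2 ^ j`, the result is the bit mask of
`{φ (k ^ 2 + 2 * (a + i)) / 2 | i ∈ s}`. -/
noncomputable def image (k j : ℕ) : ℕ → ℕ → ℕ :=
  Nat.rec
    (fun a mask => bif Nat.beq mask 0 then 0
      else Nat.shiftLeft 1 (totientFast 20 (k * k + 2 * a) / 2))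
    (fun j ih a mask => force mask fun m => bif Nat.beq m 0 then 0
      else Nat.lor (ih a (m % 2 ^ 2 ^ j)) (ih (a + 2 ^ j) (Nat.shiftRight m (2 ^ j))))
    j

theorem image_succ (k j a mask : ℕ) : image k (j + 1) a mask =
    if mask = 0 then 0
    else image k j a (mask % 2 ^ 2 ^ j) ||| image k j (a + 2 ^ j) (mask >>> 2 ^ j) := by
  have h : image k (j + 1) a mask = force mask fun m => bif Nat.beq m 0 then 0
      else Nat.lor (image k j a (m % 2 ^ 2 ^ j))
        (image k j (a + 2 ^ j) (Nat.shiftRight m (2 ^ j))) := rfl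
  rw [h, force_eq, Bool.cond_eq_ite]
  simp only [Nat.beq_eq]
  rfl

theorem testBit_image (k j : ℕ) : ∀ a mask i : ℕ, i < 2 ^ j → mask.testBit i = true →
    (image k j a mask).testBit (Nat.totient (k ^ 2 + 2 * (a + i)) / 2) = true := by
  induction j with
  | zero =>
    intro a mask i hi hm
    have hi0 : i = 0 := by simpa using hi
    subst hi0
    have hm0 : mask ≠ 0 := by rintro rfl; simp at hm
    have h : image k 0 a mask = bif Nat.beq mask 0 then 0
      else 1 <<< (totientFast 20 (k * k + 2 * a) / 2) := rfl
    rw [h, Bool.cond_eq_ite]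
    simp only [Nat.beq_eq, hm0, if_false, totientFast_eq, ← pow_two, add_zero]
    simp [Nat.shiftLeft_eq]
  | succ j ih =>
    intro a mask i hi hm
    have hm0 : mask ≠ 0 := by rintro rfl; simp at hm
    rw [image_succ, if_neg hm0, Nat.testBit_or, Bool.or_eq_true]
    rcases lt_or_ge i (2 ^ j) with h | h
    · left
      exact ih a _ i h (by simp [Nat.testBit_mod_two_pow, h, hm])
    · right
      have h1 := ih (a + 2 ^ j) (mask >>> 2 ^ j) (i - 2 ^ j) (by rw [pow_succ] at hi; omega)
        (by rw [Nat.testBit_shiftRight, Nat.add_sub_cancel' h, hm])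
      rwa [add_assoc, Nat.add_sub_cancel' h] at h1

/-- Bit masks of sets containing the halved partial evaluations with index `K - t`, starting from
all numbers below `B`. -/
noncomputable def reach (K B t : ℕ) : ℕ :=
  Nat.rec (2 ^ B - 1) (fun t ih => image (K - t) 15 0 ih) t

/-- The iteration `scorePartial` for the squares, with the fast totient. -/
noncomputable def scoreFast (n j : ℕ) : ℕ :=
  Nat.rec 0 (fun j ih => force (n - j) fun k => totientFast 20 (k * k + ih)) j

theorem scoreFast_eq (n j : ℕ) : scoreFast n j = scorePartial (fun j => j ^ 2) n j := by
  induction j with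
  | zero => rfl
  | succ j ih =>
    have h : scoreFast n (j + 1) =
      force (n - j) fun k => totientFast 20 (k * k + scoreFast n j) := rfl
    rw [h, force_eq, totientFast_eq, ih, ← pow_two]
    rfl

theorem reach_final : (reach 119 15015 119).testBit 11 = false := by
  decide +kernel

theorem scoreFast_small : ∀ n < 120, 1 ≤ n → (scoreFast n n = 22 ↔
    n ∈ ({9, 14, 15, 17, 24, 26, 30, 31, 32, 33, 34, 35, 38, 40, 47,
        53, 59, 69} : Finset ℕ)) := by
  decide +kernel

/-- `A^φ(n, k)` for the squares. -/
def partialEval (n k : ℕ) : ℕ := scorePartial (fun j => j ^ 2) n (n - k)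

theorem partialEval_of_lt {n k : ℕ} (h : k < n) :
    partialEval n k = Nat.totient ((k + 1) ^ 2 + partialEval n (k + 1)) := by
  unfold partialEval
  obtain ⟨m, rfl⟩ := Nat.exists_eq_add_of_lt h
  rw [show k + m + 1 - k = m + 1 by omega, show k + m + 1 - (k + 1) = m by omega, scorePartial,
    show k + m + 1 - m = k + 1 by omega]

theorem partialEval_even {n k : ℕ} (hk : 1 ≤ k) (h : k ≤ n) : Even (partialEval n k) := by
  rcases h.eq_or_lt with rfl | h
  · simp [partialEval, scorePartial]
  · rw [partialEval_of_lt h]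
    exact Nat.totient_even (by nlinarith)

theorem totient_two_mul_le (q : ℕ) : Nat.totient (2 * q) ≤ q := by
  induction q using Nat.strong_induction_on with
  | _ q ih =>
    by_cases hq : 2 ∣ q
    · rw [Nat.totient_mul_of_prime_of_dvd Nat.prime_two hq]
      obtain ⟨r, rfl⟩ := hq
      rcases Nat.eq_zero_or_pos r with rfl | hr
      · simp
      · exact Nat.mul_le_mul_left 2 (ih r (by omega))
    · rw [Nat.totient_mul_of_prime_of_not_dvd Nat.prime_two hq]
      have := Nat.totient_le q
      omega

theorem partialEval_odd_le (n d : ℕ) : ∀ k, Odd k → n ≤ k + d →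
    partialEval n k ≤ 2 * k ^ 2 + 14 * k + 41 := by
  induction d using Nat.strong_induction_on with
  | _ d ih =>
    intro k hk hd
    rcases le_or_gt n k with h | h
    · simp [partialEval, Nat.sub_eq_zero_of_le h, scorePartial]
    · have hnext : partialEval n (k + 1) ≤ (k + 2) ^ 2 + (2 * (k + 2) ^ 2 + 14 * (k + 2) + 41) := by
        rcases le_or_gt n (k + 1) with h1 | h1
        · simp [partialEval, Nat.sub_eq_zero_of_le h1, scorePartial]
        · rw [partialEval_of_lt h1]
          refine (Nat.totient_le _).trans (Nat.add_le_add_left ?_ _)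
          rcases le_or_gt n (k + 2) with h2 | h2
          · simp [partialEval, Nat.sub_eq_zero_of_le h2, scorePartial]
          · exact ih (d - 2) (by omega) (k + 2) (hk.add_even even_two) (by omega)
      rw [partialEval_of_lt h]
      obtain ⟨q, hq⟩ : Even ((k + 1) ^ 2 + partialEval n (k + 1)) :=
        (hk.add_one.pow_of_ne_zero two_ne_zero).add (partialEval_even (by omega) h)
      have hle := totient_two_mul_le q
      rw [two_mul, ← hq] at hle
      nlinarith

theorem partialEval_lt {n k : ℕ} (hn : 119 < n) (hk : k ≤ 119) : partialEval n k < 2 ^ 16 := by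
  have h0 : ∀ k, Odd k → partialEval n k ≤ 2 * k ^ 2 + 14 * k + 41 := fun k hk =>
    partialEval_odd_le n n k hk (by omega)
  rcases Nat.even_or_odd k with h | h
  · have h1 : k + 1 ≤ 119 := by
      obtain ⟨r, rfl⟩ := h
      omega
    have h2 := h0 (k + 1) h.add_one
    rw [partialEval_of_lt (by omega)]
    have h3 := Nat.totient_le ((k + 1) ^ 2 + partialEval n (k + 1))
    nlinarith
  · have := h0 k h
    nlinarith

theorem testBit_reach {n : ℕ} (hn : 119 < n) (t : ℕ) (ht : t ≤ 119) :
    (reach 119 15015 t).testBit (partialEval n (119 - t) / 2) = true := by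
  induction t with
  | zero =>
    have h := partialEval_odd_le n n 119 (by decide) (by omega)
    have h0 : reach 119 15015 0 = 2 ^ 15015 - 1 := rfl
    rw [h0, Nat.testBit_two_pow_sub_one, decide_eq_true_eq, Nat.sub_zero]
    omega
  | succ t ih =>
    have h : reach 119 15015 (t + 1) = image (119 - t) 15 0 (reach 119 15015 t) := rfl
    have hlt := partialEval_lt hn (Nat.sub_le 119 t)
    have h1 := testBit_image (119 - t) 15 0 _ (partialEval n (119 - t) / 2) (by omega)
      (ih (by omega))
    rw [zero_add, Nat.two_mul_div_two_of_even (partialEval_even (by omega) (by omega))] at h1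
    rw [h, partialEval_of_lt (by omega), show 119 - (t + 1) + 1 = 119 - t by omega]
    exact h1

end SquareScore

theorem stmt_13 (n : ℕ) (hn : 1 ≤ n) :
    scorePartial (fun j => j ^ 2) n n = 22 ↔
      n ∈ ({9, 14, 15, 17, 24, 26, 30, 31, 32, 33, 34, 35, 38, 40, 47,
        53, 59, 69} : Finset ℕ) := by
  rcases Nat.lt_or_ge n 120 with h | h
  · rw [← SquareScore.scoreFast_eq]
    exact SquareScore.scoreFast_small n h hn
  · refine iff_of_false (fun h22 => ?_) (fun hmem => ?_)
    · have h1 := SquareScore.testBit_reach h 119 le_rfl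
      have h2 : SquareScore.partialEval n (119 - 119) = 22 := h22
      rw [h2, SquareScore.reach_final] at h1
      exact Bool.false_ne_true h1
    · have hall : ∀ m ∈ ({9, 14, 15, 17, 24, 26, 30, 31, 32, 33, 34, 35, 38, 40, 47,
        53, 59, 69} : Finset ℕ), m < 120 := by decide
      exact absurd (hall n hmem) (by omega)
end

section
/- If A = (a₁, a₂, a₃, ...) is a bounded sequence of positive integers (i.e., there exists M such that a_k ≤ M for all k ≥ 1), then the scoreboard sequence is bounded: there exists C such that A^φ(n) ≤ C for all n ≥ 1. -/
theorem Nat.totient_mul_add_le {j : ℕ} (hj : 2 ≤ j) (m : ℕ) :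
    Nat.totient (j * m) + m ≤ j * m := by
  have hcop : ((Finset.range (j * m)).filter (fun k => ¬ (j * m).Coprime k)).card ≥ m := by
    calc m = ((Finset.range m).image (fun i => j * i)).card := by
          rw [Finset.card_image_of_injective _ (mul_right_injective₀ (by omega)),
            Finset.card_range]
      _ ≤ _ := by
          refine Finset.card_le_card fun k hk => ?_
          obtain ⟨i, hi, rfl⟩ := Finset.mem_image.1 hk
          rw [Finset.mem_range] at hi
          refine Finset.mem_filter.2 ⟨Finset.mem_range.2 ?_, ?_⟩
          · exact Nat.mul_lt_mul_of_pos_left hi (by omega)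
          · exact Nat.not_coprime_of_dvd_of_dvd (by omega)
              (Nat.dvd_mul_right j m) (Nat.dvd_mul_right j i)
  have hsum := Finset.card_filter_add_card_filter_not (s := Finset.range (j * m))
    (fun k => (j * m).Coprime k)
  rw [Finset.card_range] at hsum
  rw [Nat.totient_eq_card_coprime]
  omega

/-- The integers just above `M * (M + 1)! + 1` form a gap of composites that `φ` maps far enough
down to undo any increment of size at most `M`. -/
theorem Nat.totient_le_of_le_mul_factorial_add {M x : ℕ}
    (hx : x ≤ M * (M + 1).factorial + 1 + M) :
    Nat.totient x ≤ M * (M + 1).factorial + 1 := by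
  rcases Nat.lt_or_ge (M * (M + 1).factorial + 1) x with hlt | hle
  · obtain ⟨j, rfl⟩ := Nat.exists_eq_add_of_le
      (show M * (M + 1).factorial ≤ x by omega)
    have hj2 : 2 ≤ j := by omega
    obtain ⟨q, hq⟩ := Nat.dvd_factorial (show 0 < j by omega) (show j ≤ M + 1 by omega)
    have hqpos : 1 ≤ q := by
      rcases Nat.eq_zero_or_pos q with rfl | h
      · exact absurd hq (Nat.factorial_ne_zero _)
      · exact h
    have hfactor : M * (M + 1).factorial + j = j * (M * q + 1) := by
      rw [hq]; ring
    have hle := Nat.totient_mul_add_le hj2 (M * q + 1)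
    have hMq : M ≤ M * q := Nat.le_mul_of_pos_right M hqpos
    rw [← hfactor] at hle
    omega
  · exact (Nat.totient_le x).trans hle

theorem stmt_15 (a : ℕ → ℕ) (hpos : ∀ k, 1 ≤ k → 1 ≤ a k)
    (M : ℕ) (hM : ∀ k, 1 ≤ k → a k ≤ M) :
    ∃ C : ℕ, ∀ n, 1 ≤ n → scorePartial a n n ≤ C := by
  refine ⟨M * (M + 1).factorial + 1, fun n _ => ?_⟩
  suffices h : ∀ j ≤ n, scorePartial a n j ≤ M * (M + 1).factorial + 1 from h n le_rfl
  intro j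
  induction j with
  | zero => intro _; simp [scorePartial]
  | succ j ih =>
    intro hj
    rw [scorePartial]
    have ha := hM (n - j) (by omega)
    have hprev := ih (by omega)
    exact Nat.totient_le_of_le_mul_factorial_add (by omega)
end
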